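/- arXiv:1601.04482 — 2 statements merged into one kernel-verified Lean document; each statement's English description precedes it below -/
import Mathlib

section
/- Let ρ, q, r be real numbers with ρ ≥ 0 and r ≥ 0. There exists a finite nonnegative Borel measure μ on [0,1] with μ([0,1]) = ρ, ∫ v dμ(v) = q and ∫ v² dμ(v) = r if and only if q² ≤ ρ r and r ≤ q. (Realizability characterization for the half-moment problem on [0,1].) -/
open MeasureTheory

/-- realizability characterization for the half-moment problem on [0,1]:
a finite nonnegative Borel measure on [0,1] with moments (ρ, q, r) exists iff
q² ≤ ρr and r ≤ q. -/
theorem half_moment_problem_realizability (ρ q r : ℝ) (hρ : 0 ≤ ρ) (hr : 0 ≤ r) :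
    (∃ μ : Measure ℝ, IsFiniteMeasure μ ∧
        μ (Set.Icc (0 : ℝ) 1)ᶜ = 0 ∧
        (μ (Set.Icc (0 : ℝ) 1)).toReal = ρ ∧
        (∫ v, v ∂μ) = q ∧
        (∫ v, v ^ 2 ∂μ) = r) ↔
      (q ^ 2 ≤ ρ * r ∧ r ≤ q) := by
  constructor
  · rintro ⟨μ, hfin, hsupp, hm, hq, hr2⟩
    have hae : ∀ᵐ v ∂μ, v ∈ Set.Icc (0 : ℝ) 1 := by
      rw [ae_iff]; exact hsupp
    have huniv : μ.real Set.univ = ρ := by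
      rw [← hm, measureReal_def]
      congr 1
      exact (measure_eq_measure_of_null_sdiff (Set.subset_univ _)
        (by rw [← Set.compl_eq_univ_sdiff]; exact hsupp)).symm
    have i1 : Integrable (fun v : ℝ => v) μ := by
      refine Integrable.of_bound (by fun_prop) 1 ?_
      filter_upwards [hae] with v hv
      rw [Real.norm_eq_abs, abs_le]
      constructor <;> linarith [hv.1, hv.2]
    have i2 : Integrable (fun v : ℝ => v ^ 2) μ := by
      refine Integrable.of_bound (by fun_prop) 1 ?_
      filter_upwards [hae] with v hv
      rw [Real.norm_eq_abs, abs_le]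
      constructor <;> nlinarith [hv.1, hv.2]
    have key : ∀ a b : ℝ, 0 ≤ a ^ 2 * r - 2 * a * b * q + b ^ 2 * ρ := by
      intro a b
      have h0 : 0 ≤ ∫ v, (a * v - b) ^ 2 ∂μ := integral_nonneg fun v => sq_nonneg _
      have h1 : ∫ v, (a * v - b) ^ 2 ∂μ
          = ∫ v, (a ^ 2 * v ^ 2 - 2 * a * b * v + b ^ 2) ∂μ := by
        congr 1; ext v; ring
      have i3 : Integrable (fun v : ℝ => a ^ 2 * v ^ 2 - 2 * a * b * v) μ :=
        (i2.const_mul _).sub (i1.const_mul _)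
      rw [h1, integral_add i3 (integrable_const _),
        integral_sub (i2.const_mul _) (i1.const_mul _), integral_const_mul, integral_const_mul,
        integral_const, hq, hr2, huniv, smul_eq_mul] at h0
      linarith
    refine ⟨?_, ?_⟩
    · rcases hρ.eq_or_lt with h | h
      · subst h
        have := key q (r + 1)
        nlinarith [sq_nonneg q, mul_nonneg (sq_nonneg q) hr]
      · have := key ρ q
        have h2 : 0 ≤ ρ * (ρ * r - q ^ 2) := by linarith
        linarith [nonneg_of_mul_nonneg_right h2 h]
    · rw [← hq, ← hr2]
      refine integral_mono_ae i2 i1 ?_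
      filter_upwards [hae] with v hv
      nlinarith [hv.1, hv.2]
  · rintro ⟨h1, h2⟩
    have hq0 : 0 ≤ q := hr.trans h2
    obtain ⟨c, x, hc, hcρ, hx0, hx1, hcx, hcx2⟩ : ∃ c x : ℝ, 0 ≤ c ∧ c ≤ ρ ∧ 0 ≤ x ∧ x ≤ 1 ∧
        c * x = q ∧ c * x ^ 2 = r := by
      rcases hr.eq_or_lt with h | h
      · subst h
        have : q = 0 := by nlinarith
        exact ⟨0, 0, by simp [hρ, this]⟩
      · have hqp : 0 < q := h.trans_le h2
        refine ⟨q ^ 2 / r, r / q, by positivity, ?_, by positivity, ?_, ?_, ?_⟩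
        · rwa [div_le_iff₀ h]
        · rwa [div_le_one hqp]
        · field_simp
        · field_simp
    have hd : 0 ≤ ρ - c := by linarith
    have int : ∀ (f : ℝ → ℝ) (a y : ℝ),
        Integrable f (ENNReal.ofReal a • Measure.dirac y) := fun f a y =>
      (integrable_dirac (by simp)).smul_measure ENNReal.ofReal_ne_top
    refine ⟨ENNReal.ofReal c • Measure.dirac x + ENNReal.ofReal (ρ - c) • Measure.dirac 0,
      ⟨?_⟩, ?_, ?_, ?_, ?_⟩
    · simp
    · simp [hx0, hx1]
    · simp [hx0, hx1, ← ENNReal.ofReal_add hc hd, hρ]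
    · rw [integral_add_measure (int _ _ _) (int _ _ _)]
      simp [hc, hcx]
    · rw [integral_add_measure (int _ _ _) (int _ _ _)]
      simp [hc, hcx2]
end

section
/- Let η(z) = z log z − z be the Maxwell–Boltzmann entropy (with η(0) = 0) and let g*(v) = exp(a + bv) on [0,1] for reals a, b. If g : [0,1] → ℝ is integrable with g ≥ 0 almost everywhere, η ∘ g is integrable, and g has the same zeroth and first half-moments as g* (i.e. ∫₀¹ g = ∫₀¹ g* and ∫₀¹ v g(v) dv = ∫₀¹ v g*(v) dv), then ∫₀¹ η(g*(v)) dv ≤ ∫₀¹ η(g(v)) dv. Hence the exponential ansatz solves the constrained entropy minimization problem defining the minimum-entropy closure. -/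
open MeasureTheory

/-- the exponential ansatz g*(v) = exp(a + bv) minimizes the
Maxwell–Boltzmann entropy functional among a.e. nonnegative densities with the
same zeroth and first half-moments on [0,1]. -/
theorem exp_ansatz_minimizes_entropy (a b : ℝ) (η : ℝ → ℝ)
    (hη : ∀ z, η z = z * Real.log z - z)
    (g : ℝ → ℝ)
    (hg : IntegrableOn g (Set.Icc (0 : ℝ) 1))
    (hpos : ∀ᵐ v ∂(volume.restrict (Set.Icc (0 : ℝ) 1)), 0 ≤ g v)
    (hηg : IntegrableOn (fun v => η (g v)) (Set.Icc (0 : ℝ) 1))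
    (h0 : (∫ v in Set.Icc (0 : ℝ) 1, g v) = ∫ v in Set.Icc (0 : ℝ) 1, Real.exp (a + b * v))
    (h1 : (∫ v in Set.Icc (0 : ℝ) 1, v * g v) =
      ∫ v in Set.Icc (0 : ℝ) 1, v * Real.exp (a + b * v)) :
    (∫ v in Set.Icc (0 : ℝ) 1, η (Real.exp (a + b * v))) ≤
      ∫ v in Set.Icc (0 : ℝ) 1, η (g v) := by
  have key : ∀ z L : ℝ, 0 ≤ z → L * z - Real.exp L ≤ z * Real.log z - z := by
    intro z L hz
    rcases hz.eq_or_lt with h | h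
    · rw [← h]
      simp [Real.exp_nonneg]
    · have h2 := Real.add_one_le_exp (L - Real.log z)
      rw [Real.exp_sub, Real.exp_log h, le_div_iff₀ h] at h2
      nlinarith
  have hE : IntegrableOn (fun v : ℝ => Real.exp (a + b * v)) (Set.Icc (0 : ℝ) 1) :=
    (by fun_prop : Continuous (fun v : ℝ => Real.exp (a + b * v))).continuousOn.integrableOn_Icc
  have hvE : IntegrableOn (fun v : ℝ => v * Real.exp (a + b * v)) (Set.Icc (0 : ℝ) 1) :=
    (by fun_prop : Continuous (fun v : ℝ => v * Real.exp (a + b * v))).continuousOn.integrableOn_Icc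
  have hvg : IntegrableOn (fun v : ℝ => v * g v) (Set.Icc (0 : ℝ) 1) :=
    hg.continuousOn_mul continuousOn_id isCompact_Icc
  have split : ∀ f : ℝ → ℝ, IntegrableOn f (Set.Icc (0 : ℝ) 1) →
      IntegrableOn (fun v : ℝ => v * f v) (Set.Icc (0 : ℝ) 1) →
      Integrable (fun v => a * f v + b * (v * f v) - Real.exp (a + b * v))
        (volume.restrict (Set.Icc (0 : ℝ) 1)) ∧
      (∫ v in Set.Icc (0 : ℝ) 1, (a * f v + b * (v * f v) - Real.exp (a + b * v))) =
      a * (∫ v in Set.Icc (0 : ℝ) 1, f v) + b * (∫ v in Set.Icc (0 : ℝ) 1, v * f v)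
        - ∫ v in Set.Icc (0 : ℝ) 1, Real.exp (a + b * v) := by
    intro f hf hvf
    have i1 := Integrable.const_mul hf a
    have i2 := Integrable.const_mul hvf b
    have i3 : Integrable (fun x => a * f x + b * (x * f x))
        (volume.restrict (Set.Icc (0 : ℝ) 1)) := i1.add i2
    refine ⟨i3.sub hE, ?_⟩
    rw [integral_sub i3 hE, integral_add i1 i2, integral_const_mul, integral_const_mul]
  have e1 : (∫ v in Set.Icc (0 : ℝ) 1, η (Real.exp (a + b * v))) =
      ∫ v in Set.Icc (0 : ℝ) 1, (a * g v + b * (v * g v) - Real.exp (a + b * v)) := by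
    rw [(split g hg hvg).2, h0, h1, ← (split _ hE hvE).2]
    congr 1
    funext v
    rw [hη, Real.log_exp]
    ring
  rw [e1]
  refine integral_mono_ae (split g hg hvg).1 hηg ?_
  filter_upwards [hpos] with v hv
  have := key (g v) (a + b * v) hv
  rw [hη]
  linarith
end
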